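/- Let w, r and r₁,...,r_w be integers with r ≤ r_j for all j. Define the block matrix T = [T_{i,j}] where T_{i,j} is an r×r_j dense (i.i.d. uniform over F₂) matrix if j ≤ i, and arbitrary if i < j. Let n = wr, r_min = min_j r_j, and u = ⌈(n−γ)/r⌉. Then for every integer 0 ≤ γ ≤ n−1, Pr[rank(T) < n−γ] ≤ u · (1 − 2^{−r}) · 2^{−γ + n − w·r_min + (r_min − r)(u−1)}. -/

import Mathlib

open MeasureTheory ProbabilityTheory

noncomputable instance : MeasurableSpace (ZMod 2) := ⊤

/-- The vectors over `ZMod 2` supported on the first `k` coordinates. -/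
def vanishingFrom (n k : ℕ) : Finset (Fin n → ZMod 2) :=
  Fintype.piFinset fun a => if a.val < k then Finset.univ else {0}

lemma mem_vanishingFrom {n k : ℕ} {x : Fin n → ZMod 2} :
    x ∈ vanishingFrom n k ↔ ∀ a : Fin n, k ≤ a.val → x a = 0 := by
  simp only [vanishingFrom, Fintype.mem_piFinset]
  refine forall_congr' fun a => ?_
  by_cases h : a.val < k
  · simp [h]
  · simp [h, not_lt.mp h]

lemma vanishingFrom_mono {n k l : ℕ} (h : k ≤ l) : vanishingFrom n k ⊆ vanishingFrom n l :=
  fun _ hx => mem_vanishingFrom.2 fun a ha => mem_vanishingFrom.1 hx a (h.trans ha)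

lemma card_vanishingFrom {n k : ℕ} (h : k ≤ n) : (vanishingFrom n k).card = 2 ^ k := by
  have hcard : ∀ a : Fin n, (if a.val < k then Finset.univ else {0} : Finset (ZMod 2)).card
      = if a.val < k then 2 else 1 := by
    intro a
    split_ifs <;> simp [ZMod.card]
  rw [vanishingFrom, Fintype.card_piFinset]
  simp only [hcard]
  rw [Finset.prod_ite, Finset.prod_const, Finset.prod_const_one, mul_one,
    Fin.card_filter_val_lt, min_eq_right h]

/-- A sum over the vectors not supported on the first `l` blocks, split by last nonzero block. -/
lemma sum_compl_vanishingFrom (w r l : ℕ) (hl : l ≤ w) (f : (Fin (w * r) → ZMod 2) → ℝ) :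
    ∑ x ∈ Finset.univ \ vanishingFrom (w * r) (l * r), f x
      = ∑ b ∈ Finset.Ico l w, ∑ x ∈ vanishingFrom (w * r) ((b + 1) * r) \
          vanishingFrom (w * r) (b * r), f x := by
  have huniv : Finset.univ = vanishingFrom (w * r) (w * r) := by
    ext x
    simp only [Finset.mem_univ, mem_vanishingFrom, true_iff]
    intro a ha
    omega
  have hstep : ∀ b, ∑ x ∈ vanishingFrom (w * r) ((b + 1) * r) \
      vanishingFrom (w * r) (b * r), f x
      = ∑ x ∈ vanishingFrom (w * r) ((b + 1) * r), f x
        - ∑ x ∈ vanishingFrom (w * r) (b * r), f x := fun b =>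
    Finset.sum_sdiff_eq_sub (vanishingFrom_mono (Nat.mul_le_mul_right r b.le_succ))
  rw [huniv, Finset.sum_sdiff_eq_sub (vanishingFrom_mono (Nat.mul_le_mul_right r hl))]
  simp only [hstep]
  exact (Finset.sum_Ico_sub (fun b => ∑ x ∈ vanishingFrom (w * r) (b * r), f x) hl).symm

lemma card_vecMul_eq_zero {n : ℕ} {κ : Type*} [Fintype κ] (M : Matrix (Fin n) κ (ZMod 2)) :
    (Finset.univ.filter fun x => Matrix.vecMul x M = 0).card = 2 ^ (n - M.rank) := by
  classical
  have hdim := LinearMap.finrank_range_add_finrank_ker M.transpose.mulVecLin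
  have hrank : Module.finrank (ZMod 2) (LinearMap.range M.transpose.mulVecLin) = M.rank :=
    Matrix.rank_transpose M
  have hker : Module.finrank (ZMod 2) (LinearMap.ker M.transpose.mulVecLin) = n - M.rank := by
    rw [hrank, Module.finrank_fin_fun] at hdim
    omega
  rw [← hker]
  have h := Module.card_eq_pow_finrank (K := ZMod 2)
    (V := LinearMap.ker M.transpose.mulVecLin)
  rw [ZMod.card] at h
  rw [← h, ← Fintype.card_coe]
  refine Fintype.card_congr (Equiv.subtypeEquivRight fun x => ?_)
  simp

/-- A matrix of rank less than `n - γ` has at least `2 ^ γ` left null vectors outside any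
set of size at most `2 ^ γ`. -/
lemma pow_le_card_null_sdiff {n γ : ℕ} {κ : Type*} [Fintype κ] (M : Matrix (Fin n) κ (ZMod 2))
    (hM : M.rank < n - γ) (V : Finset (Fin n → ZMod 2)) (hV : V.card ≤ 2 ^ γ) :
    2 ^ γ ≤ ((Finset.univ \ V).filter fun x => Matrix.vecMul x M = 0).card := by
  have hsub : (Finset.univ.filter fun x => Matrix.vecMul x M = 0) \ V
      ⊆ (Finset.univ \ V).filter fun x => Matrix.vecMul x M = 0 := by
    intro x
    simp +contextual
  have h1 := Finset.card_le_card hsub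
  have h2 := Finset.le_card_sdiff V (Finset.univ.filter fun x => Matrix.vecMul x M = 0)
  rw [card_vecMul_eq_zero] at h2
  have h3 : 2 ^ (γ + 1) ≤ 2 ^ (n - M.rank) := Nat.pow_le_pow_right two_pos (by omega)
  rw [pow_succ] at h3
  omega

/-- The matrix with entries `g` on `S` and entries `A` off `S`. -/
def fillMatrix {ι κ : Type*} [DecidableEq ι] [DecidableEq κ] (S : Finset (ι × κ))
    (A : ι → κ → ZMod 2) (g : S → ZMod 2) : Matrix ι κ (ZMod 2) :=
  Matrix.of fun i c => if h : (i, c) ∈ S then g ⟨(i, c), h⟩ else A i c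

/-- If `x a ≠ 0` and the entries of row `a` in the columns `C` are free, then a proportion of at
most `2 ^ (-#C)` of all fillings have `x` as a left null vector. -/
lemma card_fillMatrix_null_mul_le {ι κ : Type*} [Fintype ι] [DecidableEq ι] [Fintype κ]
    [DecidableEq κ] (S : Finset (ι × κ)) (A : ι → κ → ZMod 2) (x : ι → ZMod 2) (a : ι)
    (hx : x a ≠ 0) (C : Finset κ) (hC : ∀ c ∈ C, (a, c) ∈ S) :
    (Finset.univ.filter fun g : S → ZMod 2 => Matrix.vecMul x (fillMatrix S A g) = 0).card
      * 2 ^ C.card ≤ Fintype.card (S → ZMod 2) := by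
  let pad : (C → ZMod 2) → S → ZMod 2 := fun h p =>
    if hp : p.1.1 = a ∧ p.1.2 ∈ C then h ⟨p.1.2, hp.2⟩ else 0
  have hpad : ∀ (h : C → ZMod 2) (g : S → ZMod 2) (c : C),
      Matrix.vecMul x (fillMatrix S A (g + pad h)) c
        = Matrix.vecMul x (fillMatrix S A g) c + x a * h c := by
    intro h g c
    have hentry : ∀ i, fillMatrix S A (g + pad h) i c
        = fillMatrix S A g i c + if i = a then h c else 0 := by
      intro i
      by_cases hi : i = a
      · subst hi
        simp [fillMatrix, pad, hC c c.2]
      · simp [fillMatrix, pad, hi]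
    simp only [Matrix.vecMul, dotProduct, hentry, mul_add, Finset.sum_add_distrib, mul_ite,
      mul_zero, Finset.sum_ite_eq', Finset.mem_univ, if_true]
  have hcard : 2 ^ C.card = Fintype.card (C → ZMod 2) := by simp [ZMod.card]
  rw [hcard, ← Finset.card_univ, ← Finset.card_univ (α := S → ZMod 2), ← Finset.card_product]
  refine Finset.card_le_card_of_injOn (fun q => q.1 + pad q.2)
    (fun _ _ => Finset.mem_coe.2 (Finset.mem_univ _)) ?_
  rintro ⟨g, h⟩ hg ⟨g', h'⟩ hg' heq
  simp only [Finset.coe_product, Set.mem_prod, Finset.mem_coe, Finset.mem_filter,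
    Finset.mem_univ, true_and, and_true] at hg hg' heq
  have hh : h = h' := by
    funext c
    have e1 := hpad h g c
    have e2 := hpad h' g' c
    rw [hg] at e1
    rw [hg'] at e2
    rw [heq, e2] at e1
    simpa [hx] using e1.symm
  subst hh
  simpa using heq

/-- Markov's inequality for the number of left null vectors not supported on the first
`w - u` blocks. -/
lemma card_rank_lt_le (w r : ℕ) (rs : Fin w → ℕ) (rmin : ℕ)
    (hle : r ≤ rmin) (hmin : ∀ j, rmin ≤ rs j)
    (S : Finset (Fin (w * r) × ((j : Fin w) × Fin (rs j))))
    (hS : ∀ p : Fin (w * r) × ((j : Fin w) × Fin (rs j)),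
      p ∈ S ↔ p.2.1.val ≤ p.1.val / r)
    (A : Fin (w * r) → ((j : Fin w) × Fin (rs j)) → ZMod 2)
    (γ u : ℕ) (huw : u ≤ w) (hu : (w - u) * r ≤ γ) (hr : 1 ≤ r) :
    ((Finset.univ.filter fun g => (fillMatrix S A g).rank < w * r - γ).card : ℝ) * 2 ^ γ
      ≤ Fintype.card (S → ZMod 2) *
        (u * ((1 - 2 ^ (-(r : ℤ))) * 2 ^ (-(((rmin : ℤ) - r) * ((w : ℤ) - u + 1))))) := by
  set N : (Fin (w * r) → ZMod 2) → ℕ := fun x =>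
    (Finset.univ.filter fun g => Matrix.vecMul x (fillMatrix S A g) = 0).card with hN
  set V := vanishingFrom (w * r) ((w - u) * r) with hVdef
  have hV : V.card ≤ 2 ^ γ := by
    rw [hVdef, card_vanishingFrom (Nat.mul_le_mul_right r (Nat.sub_le w u))]
    exact Nat.pow_le_pow_right two_pos hu
  have hmarkov : (Finset.univ.filter fun g => (fillMatrix S A g).rank < w * r - γ).card * 2 ^ γ
      ≤ ∑ x ∈ Finset.univ \ V, N x := by
    calc _ ≤ ∑ g ∈ Finset.univ.filter fun g => (fillMatrix S A g).rank < w * r - γ,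
          ((Finset.univ \ V).filter fun x => Matrix.vecMul x (fillMatrix S A g) = 0).card := by
          rw [← smul_eq_mul]
          exact Finset.card_nsmul_le_sum _ _ _ fun g hg =>
            pow_le_card_null_sdiff _ (Finset.mem_filter.1 hg).2 V hV
      _ ≤ ∑ g, ((Finset.univ \ V).filter
            fun x => Matrix.vecMul x (fillMatrix S A g) = 0).card :=
          Finset.sum_le_sum_of_subset (Finset.subset_univ _)
      _ = _ := Finset.sum_card_bipartiteAbove_eq_sum_card_bipartiteBelow
          (fun g x => Matrix.vecMul x (fillMatrix S A g) = 0)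
  have hnull : ∀ b < w, ∀ x ∉ vanishingFrom (w * r) (b * r),
      (N x : ℝ) ≤ Fintype.card (S → ZMod 2) * 2 ^ (-(((b : ℤ) + 1) * rmin)) := by
    intro b hb x hx
    simp only [mem_vanishingFrom, not_forall] at hx
    obtain ⟨a, hba, hxa⟩ := hx
    let C : Finset ((j : Fin w) × Fin (rs j)) :=
      (Finset.univ.filter fun j : Fin w => j.val < b + 1).sigma fun _ => Finset.univ
    have hcol : (b + 1) * rmin ≤ C.card := by
      have hb' : (Finset.univ.filter fun j : Fin w => j.val < b + 1).card = b + 1 := by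
        rw [Fin.card_filter_val_lt, min_eq_right (by omega)]
      rw [Finset.card_sigma]
      calc _ = (Finset.univ.filter fun j : Fin w => j.val < b + 1).card • rmin := by
            rw [hb', smul_eq_mul]
        _ ≤ _ := Finset.card_nsmul_le_sum _ _ _ fun j _ => by simpa using hmin j
    have hfree : ∀ c ∈ C, (a, c) ∈ S := by
      intro c hc
      have hcb : c.1.val < b + 1 := by simpa [C] using hc
      exact (hS _).2 ((Nat.lt_succ_iff.1 hcb).trans ((Nat.le_div_iff_mul_le hr).2 hba))
    have hmul : N x * 2 ^ ((b + 1) * rmin) ≤ Fintype.card (S → ZMod 2) :=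
      (Nat.mul_le_mul_left _ (Nat.pow_le_pow_right two_pos hcol)).trans
        (card_fillMatrix_null_mul_le S A x a hxa C hfree)
    have hcast : (((b : ℤ) + 1) * rmin) = (((b + 1) * rmin : ℕ) : ℤ) := by push_cast; ring
    rw [hcast, zpow_neg, zpow_natCast, ← div_eq_mul_inv, le_div_iff₀ (by positivity)]
    exact_mod_cast hmul
  have hblock : ∀ b ∈ Finset.Ico (w - u) w,
      ∑ x ∈ vanishingFrom (w * r) ((b + 1) * r) \ vanishingFrom (w * r) (b * r), (N x : ℝ)
        ≤ Fintype.card (S → ZMod 2) *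
          ((1 - 2 ^ (-(r : ℤ))) * 2 ^ (-(((rmin : ℤ) - r) * ((w : ℤ) - u + 1)))) := by
    intro b hb
    obtain ⟨hlb, hbw⟩ := Finset.mem_Ico.1 hb
    have hcard : ((vanishingFrom (w * r) ((b + 1) * r) \ vanishingFrom (w * r) (b * r)).card : ℝ)
        = (1 - 2 ^ (-(r : ℤ))) * 2 ^ (((b : ℤ) + 1) * r) := by
      rw [Finset.cast_card_sdiff (vanishingFrom_mono (Nat.mul_le_mul_right r b.le_succ)),
        card_vanishingFrom (Nat.mul_le_mul_right r hbw),
        card_vanishingFrom (Nat.mul_le_mul_right r hbw.le), sub_mul, one_mul,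
        ← zpow_add₀ two_ne_zero]
      push_cast
      rw [← zpow_natCast, ← zpow_natCast]
      congr 2
      push_cast
      ring
    have hfac : (0 : ℝ) ≤ 1 - 2 ^ (-(r : ℤ)) :=
      sub_nonneg.2 (zpow_le_one_of_nonpos₀ one_le_two (by omega))
    calc _ ≤ _ := Finset.sum_le_card_nsmul _ _ _ fun x hx =>
          hnull b hbw x (Finset.mem_sdiff.1 hx).2
      _ = Fintype.card (S → ZMod 2) * ((1 - 2 ^ (-(r : ℤ))) *
            2 ^ (-(((rmin : ℤ) - r) * ((b : ℤ) + 1)))) := by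
          have hexp : -(((rmin : ℤ) - r) * ((b : ℤ) + 1))
              = ((b : ℤ) + 1) * r + -(((b : ℤ) + 1) * rmin) := by ring
          rw [nsmul_eq_mul, hcard, hexp, zpow_add₀ two_ne_zero]
          ring
      _ ≤ _ := by
          gcongr
          · exact one_le_two
          · exact sub_nonneg.2 (by exact_mod_cast hle)
          · omega
  calc _ ≤ ∑ x ∈ Finset.univ \ V, (N x : ℝ) := by exact_mod_cast hmarkov
    _ = _ := sum_compl_vanishingFrom w r (w - u) (Nat.sub_le w u) fun x => (N x : ℝ)
    _ ≤ _ := Finset.sum_le_card_nsmul _ _ _ hblock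
    _ = _ := by
        rw [Nat.card_Ico, Nat.sub_sub_self huw, nsmul_eq_mul]
        ring

/-- An event depending on a uniformly distributed variable has probability equal to the
proportion of favourable values. -/
lemma toReal_measure_preimage_of_map_uniform {Ω G : Type*} [MeasurableSpace Ω]
    (μ : Measure Ω) [Fintype G] [Nonempty G] [MeasurableSpace G]
    [MeasurableSingletonClass G] (X : Ω → G)
    (hX : μ.map X = (PMF.uniformOfFintype G).toMeasure) (P : G → Prop) [DecidablePred P] :
    (μ {ω | P (X ω)}).toReal = (Finset.univ.filter P).card / Fintype.card G := by
  classical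
  have hae : AEMeasurable X μ := by
    apply AEMeasurable.of_map_ne_zero
    rw [hX]
    exact IsProbabilityMeasure.ne_zero _
  have hmeas : MeasurableSet {g | P g} := (Set.toFinite _).measurableSet
  have h := Measure.map_apply_of_aemeasurable hae hmeas
  rw [hX, PMF.toMeasure_uniformOfFintype_apply _ hmeas] at h
  rw [show {ω | P (X ω)} = X ⁻¹' {g | P g} from rfl, ← h, ENNReal.toReal_div]
  simp [Fintype.card_subtype]

/-- Lemma HorizontalT: T = [T_{i,j}] is a (wr)×(Σ_j r_j) block matrix
over F₂ with w block-rows of height r and w block-columns of widths r₁,…,r_w, where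
r ≤ r_j for all j, and n = wr. Blocks T_{i,j} with j ≤ i have jointly i.i.d. uniform
entries; blocks with i < j are arbitrary fixed matrices. Then for 0 ≤ γ ≤ n−1, with
u = ⌈(n−γ)/r⌉, Pr[rank(T) < n−γ] ≤ u·(1−2^{−r})·2^{−γ+n−w·r_min+(r_min−r)(u−1)}. -/
theorem rank_lower_tail_horizontal_blocks {Ω : Type} [MeasurableSpace Ω]
    (μ : Measure Ω) [IsProbabilityMeasure μ]
    (w r : ℕ) (hw : 0 < w) (hr : 1 ≤ r) (rs : Fin w → ℕ) (hrs : ∀ j, r ≤ rs j)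
    (rmin : ℕ) (hrmin : IsLeast (Set.range rs) rmin)
    (n : ℕ) (hn : n = w * r)
    (T : Ω → Fin (w * r) → ((j : Fin w) × Fin (rs j)) → ZMod 2)
    (S : Finset (Fin (w * r) × ((j : Fin w) × Fin (rs j))))
    (hS : ∀ p : Fin (w * r) × ((j : Fin w) × Fin (rs j)),
      p ∈ S ↔ p.2.1.val ≤ p.1.val / r)
    (hunif : μ.map (fun ω (p : S) => T ω p.1.1 p.1.2)
      = (PMF.uniformOfFintype (S → ZMod 2)).toMeasure)
    (A : Fin (w * r) → ((j : Fin w) × Fin (rs j)) → ZMod 2)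
    (hdet : ∀ ω i c, (i, c) ∉ S → T ω i c = A i c)
    (γ : ℕ) (hγ : γ ≤ n - 1) (u : ℕ) (hu : u = (n - γ + r - 1) / r) :
    (μ {ω | (Matrix.of (T ω)).rank < n - γ}).toReal
      ≤ (u : ℝ) * (1 - 2 ^ (-(r : ℤ)))
        * 2 ^ (-(γ : ℤ) + (n : ℤ) - (w : ℤ) * rmin + ((rmin : ℤ) - r) * ((u : ℤ) - 1)) := by
  subst hn
  obtain ⟨⟨j₀, hj₀⟩, hlower⟩ := hrmin
  have hmin : ∀ j, rmin ≤ rs j := fun j => hlower ⟨j, rfl⟩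
  have hle : r ≤ rmin := hj₀ ▸ hrs j₀
  have huw : u ≤ w := by
    rw [hu, ← Nat.lt_succ_iff, Nat.div_lt_iff_lt_mul hr, Nat.succ_mul]
    omega
  have hur : (w - u) * r ≤ γ := by
    have hlt := Nat.lt_div_mul_add (a := w * r - γ + r - 1) hr
    rw [← hu] at hlt
    rw [Nat.sub_mul]
    omega
  have hfill : ∀ ω, Matrix.of (T ω) = fillMatrix S A fun p : S => T ω p.1.1 p.1.2 := by
    intro ω
    ext i c
    by_cases h : (i, c) ∈ S
    · simp [fillMatrix, h]
    · simp [fillMatrix, h, hdet ω i c h]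
  have : MeasurableSingletonClass (ZMod 2) := ⟨fun _ => trivial⟩
  simp only [hfill]
  rw [toReal_measure_preimage_of_map_uniform μ _ hunif
    (fun g => (fillMatrix S A g).rank < w * r - γ), div_le_iff₀ (by positivity)]
  have hexp : -(γ : ℤ) + ((w * r : ℕ) : ℤ) - (w : ℤ) * rmin + ((rmin : ℤ) - r) * ((u : ℤ) - 1)
      = -(((rmin : ℤ) - r) * ((w : ℤ) - u + 1)) - γ := by
    push_cast
    ring
  have hmain := card_rank_lt_le w r rs rmin hle hmin S hS A γ u huw hur hr
  rw [hexp, zpow_sub₀ two_ne_zero, zpow_natCast]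
  rw [← le_div_iff₀ (by positivity)] at hmain
  refine hmain.trans_eq ?_
  ring
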